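/- For α, β, η ∈ ℝ define G(t,x) = p_x(t,x) + α·p₁(t,x) + β·p₂(t,x) + (1 + α + η)·a₁'(t)/a₁(t) = (3 + α + β)a₁a₂x² − ((2 + α)a₂ + (2 + α + β)a₁b₂)x + (1 + α)b₂ + η·a₁'/a₁. Assume there exist α, β, η ∈ ℝ such that G(t,x) ≥ 0 for every (t,x) ∈ V except for t in a set of measure zero, with strict inequality for every t in some set P of positive Lebesgue measure. Then equation (★) has at most one limit cycle with graph in each connected component of V; moreover, if such a limit cycle exists, it is hyperbolic and unstable. The analogous statement with G ≤ 0 (strict on a positive-measure set) yields at most one limit cycle per connected component of V, hyperbolic and stable. -/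

import Mathlib

open MeasureTheory Real Set

/-- Right-hand side of the Abel equation (★):
`x' = a₁ a₂ x³ − (a₁ b₂ + a₂) x² + (b₂ − a₁'/a₁) x`. -/
noncomputable def abelRHS (a₁ a₂ b₂ : ℝ → ℝ) (t x : ℝ) : ℝ :=
  a₁ t * a₂ t * x ^ 3 - (a₁ t * b₂ t + a₂ t) * x ^ 2 +
    (b₂ t - deriv a₁ t / a₁ t) * x

/-- `x` is a (global) solution of `x' = f t x`. -/
def IsSolution (f : ℝ → ℝ → ℝ) (x : ℝ → ℝ) : Prop :=
  ∀ t, HasDerivAt x (f t (x t)) t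

/-- `x` is a `T`-periodic solution of `x' = f t x`. -/
def IsPeriodicSolution (f : ℝ → ℝ → ℝ) (T : ℝ) (x : ℝ → ℝ) : Prop :=
  IsSolution f x ∧ Function.Periodic x T

/-- `x` is a limit cycle: a `T`-periodic solution which is isolated in the set of
all `T`-periodic solutions (isolation measured through initial conditions). -/
def IsLimitCycle (f : ℝ → ℝ → ℝ) (T : ℝ) (x : ℝ → ℝ) : Prop :=
  IsPeriodicSolution f T x ∧
    ∃ ε > 0, ∀ y : ℝ → ℝ, IsPeriodicSolution f T y → |y 0 - x 0| < ε → y 0 = x 0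

open Classical in
/-- The region `V`: if `a₁ > 0` everywhere, `V = {(t,x) : 0 < x < 1/a₁(t)}`;
if `a₁ < 0` everywhere, `V = {(t,x) : x > 0 ∨ x < 1/a₁(t)}`;
otherwise (`a₁` has zeros) `V = {(t,x) : x > 0 and x < 1/a₁(t) whenever a₁(t) > 0}`. -/
noncomputable def regionV (a₁ : ℝ → ℝ) : Set (ℝ × ℝ) :=
  if ∀ t, 0 < a₁ t then {q | 0 < q.2 ∧ q.2 < 1 / a₁ q.1}
  else if ∀ t, a₁ t < 0 then {q | 0 < q.2 ∨ q.2 < 1 / a₁ q.1}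
  else {q | 0 < q.2 ∧ (0 < a₁ q.1 → q.2 < 1 / a₁ q.1)}

/-- The partial derivative `p_x` of the right-hand side of (★). -/
noncomputable def abelPx (a₁ a₂ b₂ : ℝ → ℝ) (t x : ℝ) : ℝ :=
  3 * a₁ t * a₂ t * x ^ 2 - 2 * (a₁ t * b₂ t + a₂ t) * x +
    (b₂ t - deriv a₁ t / a₁ t)

/-- The function `G(t,x) = p_x + α p₁ + β p₂ + (1+α+η) a₁'/a₁
= (3+α+β) a₁ a₂ x² − ((2+α) a₂ + (2+α+β) a₁ b₂) x + (1+α) b₂ + η a₁'/a₁`. -/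
noncomputable def abelG (a₁ a₂ b₂ : ℝ → ℝ) (α β η : ℝ) (t x : ℝ) : ℝ :=
  (3 + α + β) * a₁ t * a₂ t * x ^ 2
    - ((2 + α) * a₂ t + (2 + α + β) * a₁ t * b₂ t) * x
    + (1 + α) * b₂ t + η * deriv a₁ t / a₁ t

/-- Right-hand side of the equation satisfied by `y = a₁ x`, with `c = a₂ / a₁` and `b = b₂`. -/
def normalizedRHS (c b y : ℝ) : ℝ := y * (y - 1) * (c * y - b)

/-- The function `G` of the Abel equation in the coordinate `y = a₁ x`, with `κ = η a₁' / a₁`. -/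
def normalizedG (α β c b κ y : ℝ) : ℝ :=
  (3 + α + β) * c * y ^ 2 - ((2 + α) * c + (2 + α + β) * b) * y + (1 + α) * b + κ

/-- The spatial factor `|y| ^ α * |y - 1| ^ β` of the Dulac function. -/
noncomputable def dulacWeight (α β y : ℝ) : ℝ := exp (α * log y + β * log (y - 1))

lemma dulacWeight_pos (α β y : ℝ) : 0 < dulacWeight α β y := exp_pos _

lemma hasDerivAt_dulacWeight (α β : ℝ) {y : ℝ} (h0 : y ≠ 0) (h1 : y ≠ 1) :
    HasDerivAt (dulacWeight α β) (dulacWeight α β y * (α / y + β / (y - 1))) y := by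
  have h1' : y - 1 ≠ 0 := sub_ne_zero.mpr h1
  have hlog1 : HasDerivAt (fun z : ℝ => log (z - 1)) (1 / (y - 1)) y :=
    ((hasDerivAt_id y).sub_const 1).log h1'
  refine (((hasDerivAt_log h0).const_mul α).add (hlog1.const_mul β)).exp.congr_deriv ?_
  simp only [dulacWeight, Pi.add_apply]
  ring

lemma eq_mul_exp_of_hasDerivAt {w q : ℝ → ℝ} (hq : Continuous q)
    (hw : ∀ t, HasDerivAt w (q t * w t) t) (t : ℝ) :
    w t = w 0 * exp (∫ s in (0 : ℝ)..t, q s) := by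
  have hd : ∀ t, HasDerivAt (fun t => w t * exp (-∫ s in (0 : ℝ)..t, q s)) 0 t := fun t => by
    have hQ := intervalIntegral.integral_hasDerivAt_right (hq.intervalIntegrable 0 t)
      (hq.stronglyMeasurableAtFilter _ _) hq.continuousAt
    refine ((hw t).mul hQ.neg.exp).congr_deriv ?_
    simp only [Pi.neg_apply]
    ring
  have hc := is_const_of_deriv_eq_zero (fun t => (hd t).differentiableAt)
    (fun t => (hd t).deriv) t 0
  simp only [intervalIntegral.integral_same, neg_zero, exp_zero, mul_one] at hc
  rw [← hc, mul_assoc, ← exp_add, neg_add_cancel, exp_zero, mul_one]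

lemma eq_of_monotone_of_periodic {F : ℝ → ℝ} {T : ℝ} (hT : 0 < T) (hF : Monotone F)
    (hper : Function.Periodic F T) (s t : ℝ) : F s = F t := by
  have key : ∀ s t, F s ≤ F t := fun s t => by
    obtain ⟨n, hn⟩ := exists_nat_ge ((s - t) / T)
    rw [div_le_iff₀ hT] at hn
    calc F s ≤ F (t + n * T) := hF (by linarith)
      _ = F t := hper.nat_mul n t
  exact le_antisymm (key s t) (key t s)

/-- Bendixson–Dulac argument: two ordered periodic solutions cannot coexist in an interval avoiding
`0` and `1` on which `σ G` is nonnegative, and positive at some time. -/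
lemma not_lt_of_normalizedG_sign {T : ℝ} (hT : 0 < T) {c b κ E : ℝ → ℝ} {α β σ : ℝ} {I : Set ℝ}
    (hIo : IsOpen I) (hIc : I.OrdConnected) (hI : ∀ z ∈ I, z ≠ 0 ∧ z ≠ 1)
    (hE : ∀ t, HasDerivAt E (κ t * E t) t) (hEpos : ∀ t, 0 < E t) (hEper : Function.Periodic E T)
    (hG : ∀ t, ∀ z ∈ I, 0 ≤ σ * normalizedG α β (c t) (b t) (κ t) z)
    {τ : ℝ} (hGτ : ∀ z ∈ I, 0 < σ * normalizedG α β (c τ) (b τ) (κ τ) z)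
    {u v : ℝ → ℝ}
    (hu : ∀ t, HasDerivAt u (normalizedRHS (c t) (b t) (u t)) t)
    (hv : ∀ t, HasDerivAt v (normalizedRHS (c t) (b t) (v t)) t)
    (huper : Function.Periodic u T) (hvper : Function.Periodic v T)
    (huI : ∀ t, u t ∈ I) (hvI : ∀ t, v t ∈ I) (hlt : ∀ t, u t < v t) : False := by
  let B := dulacWeight α β
  let Φ : ℝ → ℝ := fun z => ∫ y in (u 0)..z, B y
  have hB : ∀ z ∈ I, HasDerivAt B (B z * (α / z + β / (z - 1))) z := fun z hz =>
    hasDerivAt_dulacWeight α β (hI z hz).1 (hI z hz).2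
  have hBc : ContinuousOn B I := fun z hz => (hB z hz).continuousAt.continuousWithinAt
  have hΦ : ∀ z ∈ I, HasDerivAt Φ (B z) z := fun z hz =>
    intervalIntegral.integral_hasDerivAt_right
      ((hBc.mono (hIc.uIcc_subset (huI 0) hz)).intervalIntegrable)
      (hBc.stronglyMeasurableAtFilter hIo z hz) (hB z hz).continuousAt
  let K : ℝ → ℝ → ℝ := fun t z => σ * (B z * normalizedRHS (c t) (b t) z + κ t * Φ z)
  have hK : ∀ t, ∀ z ∈ I,
      HasDerivAt (K t) (B z * (σ * normalizedG α β (c t) (b t) (κ t) z)) z := fun t z hz => by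
    have h0 := (hI z hz).1
    have h1 : z - 1 ≠ 0 := sub_ne_zero.mpr (hI z hz).2
    have hf : HasDerivAt (normalizedRHS (c t) (b t))
        ((1 * (z - 1) + z * 1) * (c t * z - b t) + z * (z - 1) * (c t * 1)) z :=
      ((hasDerivAt_id z).mul ((hasDerivAt_id z).sub_const 1)).mul
        (((hasDerivAt_id z).const_mul (c t)).sub_const (b t))
    refine ((((hB z hz).mul hf).add ((hΦ z hz).const_mul (κ t))).const_mul σ).congr_deriv ?_
    simp only [normalizedRHS, normalizedG]
    field_simp
    ring
  have hsub : ∀ t, Icc (u t) (v t) ⊆ I := fun t => hIc.out (huI t) (hvI t)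
  have hKcont : ∀ t, ContinuousOn (K t) (Icc (u t) (v t)) := fun t z hz =>
    (hK t z (hsub t hz)).continuousAt.continuousWithinAt
  have hKmono : ∀ t, K t (u t) ≤ K t (v t) := fun t => by
    refine monotoneOn_of_deriv_nonneg (convex_Icc _ _) (hKcont t)
      (fun z hz => (hK t z (hsub t (interior_subset hz))).differentiableAt.differentiableWithinAt)
      (fun z hz => ?_) (left_mem_Icc.mpr (hlt t).le) (right_mem_Icc.mpr (hlt t).le) (hlt t).le
    have hzI := hsub t (interior_subset hz)
    rw [(hK t z hzI).deriv]
    exact mul_nonneg (dulacWeight_pos α β z).le (hG t z hzI)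
  have hKlt : K τ (u τ) < K τ (v τ) := by
    refine strictMonoOn_of_deriv_pos (convex_Icc _ _) (hKcont τ) (fun z hz => ?_)
      (left_mem_Icc.mpr (hlt τ).le) (right_mem_Icc.mpr (hlt τ).le) (hlt τ)
    have hzI := hsub τ (interior_subset hz)
    rw [(hK τ z hzI).deriv]
    exact mul_pos (dulacWeight_pos α β z) (hGτ z hzI)
  let F : ℝ → ℝ := fun t => σ * (E t * (Φ (v t) - Φ (u t)))
  have hF : ∀ t, HasDerivAt F (E t * (K t (v t) - K t (u t))) t := fun t => by
    refine (((hE t).mul (((hΦ _ (hvI t)).comp t (hv t)).sub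
      ((hΦ _ (huI t)).comp t (hu t)))).const_mul σ).congr_deriv ?_
    simp only [K, Pi.sub_apply, Function.comp_apply]
    ring
  have hFmono : Monotone F := monotone_of_deriv_nonneg (fun t => (hF t).differentiableAt)
    fun t => by
      rw [(hF t).deriv]
      exact mul_nonneg (hEpos t).le (sub_nonneg.mpr (hKmono t))
  have hFper : Function.Periodic F T := fun t => by
    simp only [F, hEper t, huper t, hvper t]
  have hconst : F = fun _ => F 0 :=
    funext fun t => eq_of_monotone_of_periodic hT hFmono hFper t 0
  have h0 : deriv F τ = 0 := by rw [hconst]; exact deriv_const τ _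
  rw [(hF τ).deriv] at h0
  exact (mul_pos (hEpos τ) (sub_pos.mpr hKlt)).ne' h0

lemma eq_of_normalizedG_sign {T : ℝ} (hT : 0 < T) {c b κ E : ℝ → ℝ} {α β σ : ℝ} {I : Set ℝ}
    (hIo : IsOpen I) (hIc : I.OrdConnected) (hI : ∀ z ∈ I, z ≠ 0 ∧ z ≠ 1)
    (hc : Continuous c) (hb : Continuous b)
    (hE : ∀ t, HasDerivAt E (κ t * E t) t) (hEpos : ∀ t, 0 < E t) (hEper : Function.Periodic E T)
    (hG : ∀ t, ∀ z ∈ I, 0 ≤ σ * normalizedG α β (c t) (b t) (κ t) z)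
    {τ : ℝ} (hGτ : ∀ z ∈ I, 0 < σ * normalizedG α β (c τ) (b τ) (κ τ) z)
    {u v : ℝ → ℝ}
    (hu : ∀ t, HasDerivAt u (normalizedRHS (c t) (b t) (u t)) t)
    (hv : ∀ t, HasDerivAt v (normalizedRHS (c t) (b t) (v t)) t)
    (huper : Function.Periodic u T) (hvper : Function.Periodic v T)
    (huI : ∀ t, u t ∈ I) (hvI : ∀ t, v t ∈ I) : u = v := by
  have hcu : Continuous u := continuous_iff_continuousAt.mpr fun t => (hu t).continuousAt
  have hcv : Continuous v := continuous_iff_continuousAt.mpr fun t => (hv t).continuousAt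
  let q : ℝ → ℝ := fun t =>
    c t * (v t ^ 2 + u t * v t + u t ^ 2) - (b t + c t) * (u t + v t) + b t
  have hq : Continuous q := by fun_prop
  have hw : ∀ t, HasDerivAt (fun t => v t - u t) (q t * (v t - u t)) t := fun t => by
    refine ((hv t).sub (hu t)).congr_deriv ?_
    simp only [q, normalizedRHS]
    ring
  have hexp := eq_mul_exp_of_hasDerivAt hq hw
  rcases lt_trichotomy (u 0) (v 0) with h | h | h
  · refine (not_lt_of_normalizedG_sign hT hIo hIc hI hE hEpos hEper hG hGτ hu hv huper hvper
      huI hvI fun t => ?_).elim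
    have := mul_pos (sub_pos.mpr h) (exp_pos (∫ s in (0 : ℝ)..t, q s))
    linarith [hexp t]
  · funext t
    have := hexp t
    rw [h, sub_self, zero_mul] at this
    linarith
  · refine (not_lt_of_normalizedG_sign hT hIo hIc hI hE hEpos hEper hG hGτ hv hu hvper huper
      hvI huI fun t => ?_).elim
    have := mul_pos (sub_pos.mpr h) (exp_pos (∫ s in (0 : ℝ)..t, q s))
    linarith [hexp t]

/-- If `a₁` vanishes somewhere, integrability of `a₂` and `b₂` rules out positive solutions. -/
lemma not_isSolution_pos_of_zero {T : ℝ} (hT : 0 < T) {a₁ a₂ b₂ : ℝ → ℝ}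
    (ha₁ : Differentiable ℝ a₁) (ha₁per : Function.Periodic a₁ T) (ha₁ne : ∃ t, a₁ t ≠ 0)
    (ha₁zero : ∃ t, a₁ t = 0)
    (ha₂per : Function.Periodic a₂ T) (hb₂per : Function.Periodic b₂ T)
    (ha₂int : IntervalIntegrable a₂ volume 0 T) (hb₂int : IntervalIntegrable b₂ volume 0 T)
    {x : ℝ → ℝ} (hx : IsSolution (abelRHS a₁ a₂ b₂) x) (hxpos : ∀ t, 0 < x t) : False := by
  obtain ⟨t₀, ht₀⟩ := ha₁ne
  obtain ⟨z, hz⟩ := ha₁zero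
  have hxc : Continuous x := continuous_iff_continuousAt.mpr fun t => (hx t).continuousAt
  have ha₁c := ha₁.continuous
  let S : Set ℝ := {t | t₀ ≤ t ∧ a₁ t = 0}
  have hSne : S.Nonempty := by
    obtain ⟨n, hn⟩ := exists_nat_ge ((t₀ - z) / T)
    rw [div_le_iff₀ hT] at hn
    exact ⟨z + n * T, by linarith, (ha₁per.nat_mul n z).trans hz⟩
  have hSbdd : BddBelow S := ⟨t₀, fun t ht => ht.1⟩
  have hSclosed : IsClosed S := isClosed_Ici.inter (isClosed_eq ha₁c continuous_const)
  obtain ⟨hs₀, hs⟩ : sInf S ∈ S := hSclosed.csInf_mem hSne hSbdd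
  set s := sInf S
  have hlt : t₀ < s := lt_of_le_of_ne hs₀ fun h => ht₀ (h ▸ hs)
  have hne : ∀ t, t₀ ≤ t → t < s → a₁ t ≠ 0 := fun t h₁ h₂ h =>
    (csInf_le hSbdd (show t ∈ S from ⟨h₁, h⟩)).not_gt h₂
  let h : ℝ → ℝ := fun t =>
    a₂ t * (a₁ t * x t ^ 2 - x t) + b₂ t * (1 - a₁ t * x t)
  have hint : ∀ p q, IntervalIntegrable h volume p q := fun p q =>
    ((ha₂per.intervalIntegrable₀ hT.ne' ha₂int p q).mul_continuousOn (by fun_prop)).add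
      ((hb₂per.intervalIntegrable₀ hT.ne' hb₂int p q).mul_continuousOn (by fun_prop))
  have hlog : ∀ t, t₀ ≤ t → t < s → HasDerivAt (fun t => log (a₁ t * x t)) (h t) t :=
    fun t h₁ h₂ => by
      have h0 := hne t h₁ h₂
      have hx0 := (hxpos t).ne'
      refine (((ha₁ t).hasDerivAt.mul (hx t)).log (mul_ne_zero h0 hx0)).congr_deriv ?_
      simp only [h, abelRHS, Pi.mul_apply]
      field_simp
      ring
  have hFTC : ∀ r ∈ Ico t₀ s,
      log (a₁ r * x r) = log (a₁ t₀ * x t₀) + ∫ t in t₀..r, h t := fun r hr => by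
    rw [intervalIntegral.integral_eq_sub_of_hasDerivAt (f := fun t => log (a₁ t * x t))
      (fun t ht => ?_) (hint _ _)]
    · ring
    · rw [uIcc_of_le hr.1] at ht
      exact hlog t ht.1 (ht.2.trans_lt hr.2)
  have hIco : Ico t₀ s ∈ nhdsWithin s (Iio s) := Ico_mem_nhdsLT hlt
  have hbot : Filter.Tendsto (fun r => log (a₁ r * x r)) (nhdsWithin s (Iio s)) Filter.atBot := by
    refine tendsto_log_nhdsNE_zero.comp (tendsto_nhdsWithin_iff.mpr ⟨?_, ?_⟩)
    · have : Continuous fun r => a₁ r * x r := by fun_prop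
      have := this.tendsto s
      rw [hs, zero_mul] at this
      exact this.mono_left nhdsWithin_le_nhds
    · filter_upwards [hIco] with r hr
      exact mul_ne_zero (hne r hr.1 hr.2) (hxpos r).ne'
  have hfin : Filter.Tendsto (fun r => log (a₁ r * x r)) (nhdsWithin s (Iio s))
      (nhds (log (a₁ t₀ * x t₀) + ∫ t in t₀..s, h t)) := by
    have hcont : Continuous fun r => log (a₁ t₀ * x t₀) + ∫ t in t₀..r, h t :=
      continuous_const.add (intervalIntegral.continuous_primitive hint t₀)
    refine ((hcont.tendsto s).mono_left nhdsWithin_le_nhds).congr' ?_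
    filter_upwards [hIco] with r hr
    exact (hFTC r hr).symm
  exact not_tendsto_nhds_of_tendsto_atBot hbot _ hfin

lemma IsSolution.hasDerivAt_mul {a₁ a₂ b₂ x : ℝ → ℝ} (ha₁ : Differentiable ℝ a₁)
    (hne : ∀ t, a₁ t ≠ 0) (hx : IsSolution (abelRHS a₁ a₂ b₂) x) (t : ℝ) :
    HasDerivAt (fun t => a₁ t * x t)
      (normalizedRHS (a₂ t / a₁ t) (b₂ t) (a₁ t * x t)) t := by
  have h0 := hne t
  refine ((ha₁ t).hasDerivAt.mul (hx t)).congr_deriv ?_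
  simp only [normalizedRHS, abelRHS]
  field_simp
  ring

lemma normalizedG_mul {a₁ a₂ b₂ : ℝ → ℝ} {t : ℝ} (h0 : a₁ t ≠ 0) (α β η x : ℝ) :
    normalizedG α β (a₂ t / a₁ t) (b₂ t) (η * (deriv a₁ t / a₁ t)) (a₁ t * x) =
      abelG a₁ a₂ b₂ α β η t x := by
  simp only [normalizedG, abelG]
  field_simp

lemma forall_pos_or_forall_neg {f : ℝ → ℝ} (hf : Continuous f) (hne : ∀ t, f t ≠ 0) :
    (∀ t, 0 < f t) ∨ ∀ t, f t < 0 := by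
  by_contra! h
  obtain ⟨⟨s, hs⟩, t, ht⟩ := h
  obtain ⟨r, hr⟩ := mem_range_of_exists_le_of_exists_ge hf ⟨s, hs⟩ ⟨t, ht⟩
  exact hne r hr

lemma mem_regionV_of_pos {a₁ : ℝ → ℝ} (h : ∀ t, 0 < a₁ t) {t x : ℝ} :
    (t, x) ∈ regionV a₁ ↔ a₁ t * x ∈ Ioo 0 1 := by
  simp only [regionV, if_pos h, mem_ofPred_eq, mem_Ioo, lt_div_iff₀ (h t), mul_comm x,
    mul_pos_iff_of_pos_left (h t)]

lemma mem_regionV_of_neg {a₁ : ℝ → ℝ} (h : ∀ t, a₁ t < 0) {t x : ℝ} :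
    (t, x) ∈ regionV a₁ ↔ a₁ t * x ∈ Iio 0 ∨ a₁ t * x ∈ Ioi 1 := by
  have h' : ¬ ∀ t, 0 < a₁ t := fun h'' => (h'' 0).not_gt (h 0)
  simp only [regionV, if_neg h', if_pos h, mem_ofPred_eq, mem_Iio, mem_Ioi,
    lt_div_iff_of_neg (h t), mul_comm x, mul_neg_iff, (h t).not_gt, h t, true_and, false_and,
    false_or]

lemma pos_of_mem_regionV_of_zero {a₁ : ℝ → ℝ} (h : ∃ t, a₁ t = 0) {t x : ℝ}
    (hx : (t, x) ∈ regionV a₁) : 0 < x := by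
  obtain ⟨z, hz⟩ := h
  have h₁ : ¬ ∀ t, 0 < a₁ t := fun h => (h z).ne' hz
  have h₂ : ¬ ∀ t, a₁ t < 0 := fun h => (h z).ne hz
  rw [regionV, if_neg h₁, if_neg h₂] at hx
  exact hx.1

lemma mul_ne_of_mem_regionV {a₁ : ℝ → ℝ} (hsign : (∀ t, 0 < a₁ t) ∨ ∀ t, a₁ t < 0) {t x : ℝ}
    (hx : (t, x) ∈ regionV a₁) : a₁ t * x ≠ 0 ∧ a₁ t * x ≠ 1 := by
  rcases hsign with h | h
  · have := (mem_regionV_of_pos h).mp hx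
    exact ⟨this.1.ne', this.2.ne⟩
  · rcases (mem_regionV_of_neg h).mp hx with h' | h'
    · exact ⟨h'.ne, (h'.trans one_pos).ne⟩
    · exact ⟨(one_pos.trans h').ne', h'.ne'⟩

lemma isOpen_slice_regionV {a₁ : ℝ → ℝ} (ha₁ : Continuous a₁)
    (hsign : (∀ t, 0 < a₁ t) ∨ ∀ t, a₁ t < 0) (x : ℝ) : IsOpen {t | (t, x) ∈ regionV a₁} := by
  have hc : Continuous fun t => a₁ t * x := by fun_prop
  rcases hsign with h | h
  · simp only [mem_regionV_of_pos h]
    exact isOpen_Ioo.preimage hc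
  · simp only [mem_regionV_of_neg h]
    exact (isOpen_Iio.preimage hc).union (isOpen_Ioi.preimage hc)

/-- A sign condition on a slice that holds for almost every time holds for every time. -/
lemma nonneg_of_ae_nonneg {f : ℝ → ℝ} (hf : Continuous f) {U N : Set ℝ} (hU : IsOpen U)
    (hN : volume N = 0) (h : ∀ t ∉ N, t ∈ U → 0 ≤ f t) {t : ℝ} (ht : t ∈ U) : 0 ≤ f t := by
  by_contra! hneg
  have hO : IsOpen (U ∩ f ⁻¹' Iio 0) := hU.inter (isOpen_Iio.preimage hf)
  have hsub : U ∩ f ⁻¹' Iio 0 ⊆ N := fun s hs => by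
    by_contra hsN
    exact (h s hsN hs.1).not_gt hs.2
  exact (hO.measure_pos volume ⟨t, ht, hneg⟩).ne' (measure_mono_null hsub hN)

/-- **Key Lemma.** Suppose there are `α, β, η ∈ ℝ` such that `σ G(t,x) ≥ 0` (with
`σ = ±1`) for every `(t,x) ∈ V` with `t` outside a null set `N`, the inequality
being strict for every `t` in a set `P` of positive measure. Then equation (★) has
at most one limit cycle with graph in each connected component of `V`; moreover any
limit cycle with graph in `V` is hyperbolic and unstable when `σ = 1` (resp. stable
when `σ = -1`), i.e. `σ ∫₀ᵀ p_x(t, x(t)) dt > 0`, which by the formula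
`d'(x₀) = exp(∫₀ᵀ p_x(t,u(t,x₀)) dt) − 1` says `σ d'(x₀) > 0`. -/
theorem abel_G_sign_at_most_one_limit_cycle_per_component
    (T : ℝ) (hT : 0 < T) (a₁ a₂ b₂ : ℝ → ℝ)
    (ha₁smooth : ContDiff ℝ (⊤ : ℕ∞) a₁) (ha₁per : Function.Periodic a₁ T)
    (ha₁ne : ∃ t, a₁ t ≠ 0)
    (ha₂per : Function.Periodic a₂ T) (hb₂per : Function.Periodic b₂ T)
    (ha₂smooth : ContDiffOn ℝ (⊤ : ℕ∞) a₂ {t | a₁ t ≠ 0})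
    (hb₂smooth : ContDiffOn ℝ (⊤ : ℕ∞) b₂ {t | a₁ t ≠ 0})
    (ha₂int : IntervalIntegrable a₂ volume 0 T)
    (hb₂int : IntervalIntegrable b₂ volume 0 T)
    (σ : ℝ) (hσ : σ = 1 ∨ σ = -1) (α β η : ℝ)
    (N : Set ℝ) (hN : volume N = 0)
    (hG : ∀ t ∉ N, ∀ x : ℝ, (t, x) ∈ regionV a₁ → 0 ≤ σ * abelG a₁ a₂ b₂ α β η t x)
    (P : Set ℝ) (hPpos : 0 < volume P)
    (hGP : ∀ t ∈ P, ∀ x : ℝ, (t, x) ∈ regionV a₁ → 0 < σ * abelG a₁ a₂ b₂ α β η t x) :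
    (∀ x y : ℝ → ℝ,
      IsLimitCycle (abelRHS a₁ a₂ b₂) T x → (∀ t, (t, x t) ∈ regionV a₁) →
      IsLimitCycle (abelRHS a₁ a₂ b₂) T y → (∀ t, (t, y t) ∈ regionV a₁) →
      (0, y 0) ∈ connectedComponentIn (regionV a₁) (0, x 0) →
      x = y) ∧
    (∀ x : ℝ → ℝ,
      IsLimitCycle (abelRHS a₁ a₂ b₂) T x → (∀ t, (t, x t) ∈ regionV a₁) →
      0 < σ * ∫ t in (0 : ℝ)..T, abelPx a₁ a₂ b₂ t (x t)) := by
  have ha₁d : Differentiable ℝ a₁ := ha₁smooth.differentiable (by simp)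
  have ha₁c := ha₁d.continuous
  by_cases hzero : ∃ t, a₁ t = 0
  · have hno : ∀ x, IsLimitCycle (abelRHS a₁ a₂ b₂) T x → (∀ t, (t, x t) ∈ regionV a₁) → False :=
      fun x hx hxV => not_isSolution_pos_of_zero hT ha₁d ha₁per ha₁ne hzero ha₂per hb₂per ha₂int
        hb₂int hx.1.1 fun t => pos_of_mem_regionV_of_zero hzero (hxV t)
    exact ⟨fun x _ hx hxV => (hno x hx hxV).elim, fun x hx hxV => (hno x hx hxV).elim⟩
  have hne : ∀ t, a₁ t ≠ 0 := not_exists.mp hzero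
  have hsign := forall_pos_or_forall_neg ha₁c hne
  have huniv : {t | a₁ t ≠ 0} = univ := eq_univ_of_forall hne
  rw [huniv, contDiffOn_univ] at ha₂smooth hb₂smooth
  have ha₂c := ha₂smooth.continuous
  have hb₂c := hb₂smooth.continuous
  have hda₁c : Continuous (deriv a₁) := ha₁smooth.continuous_deriv (by simp)
  have hGV : ∀ t x, (t, x) ∈ regionV a₁ → 0 ≤ σ * abelG a₁ a₂ b₂ α β η t x := fun t x htx => by
    have hGc : Continuous fun t => σ * abelG a₁ a₂ b₂ α β η t x := by
      unfold abelG
      fun_prop (disch := assumption)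
    exact nonneg_of_ae_nonneg hGc (isOpen_slice_regionV ha₁c hsign x) hN
      (fun t ht htU => hG t ht x htU) htx
  obtain ⟨τ, hτ⟩ : P.Nonempty := nonempty_of_measure_ne_zero hPpos.ne'
  have hdper : Function.Periodic (deriv a₁) T := fun t => by
    rw [← deriv_comp_add_const]
    exact congrArg (deriv · t) (funext ha₁per)
  refine ⟨fun x y hx hxV hy hyV hxy => ?_, fun x hx hxV => ?_⟩
  · have heq : ∀ I : Set ℝ, IsOpen I → I.OrdConnected →
        (∀ t z, a₁ t * z ∈ I → (t, z) ∈ regionV a₁) → (∀ t, a₁ t * x t ∈ I) →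
        (∀ t, a₁ t * y t ∈ I) → x = y := fun I hIo hIc hIV hxI hyI => by
      have hIV' : ∀ t, ∀ z ∈ I, (t, z / a₁ t) ∈ regionV a₁ := fun t z hz =>
        hIV t _ (by rwa [mul_div_cancel₀ _ (hne t)])
      have hGeq : ∀ t z, normalizedG α β (a₂ t / a₁ t) (b₂ t) (η * (deriv a₁ t / a₁ t)) z =
          abelG a₁ a₂ b₂ α β η t (z / a₁ t) := fun t z => by
        rw [← normalizedG_mul (hne t), mul_div_cancel₀ _ (hne t)]
      have hE : ∀ t, HasDerivAt (fun t => exp (η * log (a₁ t)))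
          (η * (deriv a₁ t / a₁ t) * exp (η * log (a₁ t))) t := fun t => by
        refine (((ha₁d t).hasDerivAt.log (hne t)).const_mul η).exp.congr_deriv ?_
        ring
      have h := eq_of_normalizedG_sign (c := fun t => a₂ t / a₁ t) (b := b₂)
        (α := α) (β := β) (σ := σ) (τ := τ) hT hIo hIc
        (fun z hz => by
          have := mul_ne_of_mem_regionV hsign (hIV' 0 z hz)
          rwa [mul_div_cancel₀ _ (hne 0)] at this)
        (ha₂c.div ha₁c hne) hb₂c hE (fun t => exp_pos _) (fun t => by simp only [ha₁per t])
        (fun t z hz => by rw [hGeq]; exact hGV t _ (hIV' t z hz))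
        (fun z hz => by rw [hGeq]; exact hGP τ hτ _ (hIV' τ z hz))
        (hx.1.1.hasDerivAt_mul ha₁d hne) (hy.1.1.hasDerivAt_mul ha₁d hne)
        (ha₁per.mul hx.1.2) (ha₁per.mul hy.1.2) hxI hyI
      exact funext fun t => mul_left_cancel₀ (hne t) (congrFun h t)
    rcases hsign with h | h
    · exact heq (Ioo 0 1) isOpen_Ioo ordConnected_Ioo (fun t z => (mem_regionV_of_pos h).mpr)
        (fun t => (mem_regionV_of_pos h).mp (hxV t)) (fun t => (mem_regionV_of_pos h).mp (hyV t))
    · have hV0 : ∀ q ∈ regionV a₁, q.2 ≠ 0 := fun q hq h0 =>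
        (mul_ne_of_mem_regionV (Or.inr h) (t := q.1) (x := q.2) hq).1 (by rw [h0, mul_zero])
      have hcont : ∀ w, IsLimitCycle (abelRHS a₁ a₂ b₂) T w → Continuous w := fun w hw =>
        continuous_iff_continuousAt.mpr fun t => (hw.1.1 t).continuousAt
      have hxs := forall_pos_or_forall_neg (hcont x hx) fun t => hV0 _ (hxV t)
      have hys := forall_pos_or_forall_neg (hcont y hy) fun t => hV0 _ (hyV t)
      have hsame : ¬ (0 ∈ uIcc (x 0) (y 0)) := fun h0 => by
        have hpre := (isPreconnected_connectedComponentIn (x := ((0 : ℝ), x 0))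
          (F := regionV a₁)).image Prod.snd continuous_snd.continuousOn
        obtain ⟨q, hq, hq0⟩ := hpre.ordConnected.uIcc_subset
          ⟨_, mem_connectedComponentIn (hxV 0), rfl⟩ ⟨_, hxy, rfl⟩ h0
        exact hV0 q (connectedComponentIn_subset _ _ hq) hq0
      have hneg : ∀ w : ℝ → ℝ, (∀ t, 0 < w t) → ∀ t, a₁ t * w t ∈ Iio 0 := fun w hw t =>
        mul_neg_of_neg_of_pos (h t) (hw t)
      have hone : ∀ w : ℝ → ℝ, (∀ t, (t, w t) ∈ regionV a₁) → (∀ t, w t < 0) →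
          ∀ t, a₁ t * w t ∈ Ioi 1 := fun w hwV hw t =>
        ((mem_regionV_of_neg h).mp (hwV t)).resolve_left
          (mul_pos_of_neg_of_neg (h t) (hw t)).not_gt
      rcases hxs with hxs | hxs <;> rcases hys with hys | hys
      · exact heq (Iio 0) isOpen_Iio ordConnected_Iio
          (fun t z hz => (mem_regionV_of_neg h).mpr (Or.inl hz)) (hneg x hxs) (hneg y hys)
      · exact (hsame (mem_uIcc_of_ge (hys 0).le (hxs 0).le)).elim
      · exact (hsame (mem_uIcc_of_le (hxs 0).le (hys 0).le)).elim
      · exact heq (Ioi 1) isOpen_Ioi ordConnected_Ioi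
          (fun t z hz => (mem_regionV_of_neg h).mpr (Or.inr hz)) (hone x hxV hxs) (hone y hyV hys)
  · have hxc : Continuous x := continuous_iff_continuousAt.mpr fun t => (hx.1.1 t).continuousAt
    let g : ℝ → ℝ := fun t => abelG a₁ a₂ b₂ α β η t (x t)
    let px : ℝ → ℝ := fun t => abelPx a₁ a₂ b₂ t (x t)
    have hgc : Continuous g := by
      simp only [g, abelG]
      fun_prop (disch := assumption)
    have hpxc : Continuous px := by
      simp only [px, abelPx]
      fun_prop (disch := assumption)
    let Λ : ℝ → ℝ := fun t =>
      α * log (a₁ t * x t) + β * log (a₁ t * x t - 1) + (1 + η) * log (a₁ t)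
    have hΛ : ∀ t, HasDerivAt Λ (g t - px t) t := fun t => by
      have h0 := hne t
      obtain ⟨hy0, hy1⟩ := mul_ne_of_mem_regionV hsign (hxV t)
      have hx0 : x t ≠ 0 := right_ne_zero_of_mul hy0
      have hy1' : a₁ t * x t - 1 ≠ 0 := sub_ne_zero.mpr hy1
      have hy := hx.1.1.hasDerivAt_mul ha₁d hne t
      refine ((((hy.log hy0).const_mul α).add (((hy.sub_const 1).log hy1').const_mul β)).add
        (((ha₁d t).hasDerivAt.log h0).const_mul (1 + η))).congr_deriv ?_
      simp only [g, px, abelG, abelPx, normalizedRHS]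
      field_simp
      ring
    have hgper : Function.Periodic g T := fun t => by
      simp only [g, abelG, ha₁per t, ha₂per t, hb₂per t, hdper t, hx.1.2 t]
    have hint : ∫ t in (0 : ℝ)..T, px t = ∫ t in (0 : ℝ)..T, g t := by
      have h := intervalIntegral.integral_eq_sub_of_hasDerivAt (a := 0) (b := T)
        (fun t _ => hΛ t) ((hgc.sub hpxc).intervalIntegrable _ _)
      rw [intervalIntegral.integral_sub (hgc.intervalIntegrable _ _)
        (hpxc.intervalIntegrable _ _)] at h
      have hΛT : Λ T = Λ 0 := by
        have h₁ := ha₁per 0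
        have h₂ := hx.1.2 0
        rw [zero_add] at h₁ h₂
        simp only [Λ, h₁, h₂]
      linarith
    change 0 < σ * ∫ t in (0 : ℝ)..T, px t
    have hshift := hgper.intervalIntegral_add_eq 0 τ
    rw [zero_add] at hshift
    rw [hint, hshift, ← intervalIntegral.integral_const_mul]
    exact intervalIntegral.integral_pos (by linarith) (hgc.const_mul σ).continuousOn
      (fun t _ => hGV t _ (hxV t)) ⟨τ, left_mem_Icc.mpr (by linarith), hGP τ hτ _ (hxV τ)⟩
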